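/- Assume the strictly positive gap condition and the interval support condition with parameter W, and let (f, g) be a consistent fixed point consisting of nondecreasing interpolating profiles with right-continuous inverses p^{-1}(u) := inf{x : p(x) > u}. Then for every v ∈ (0,1) there exist u ∈ (0,1) and ε > 0 such that for all (u',v') with |u'-u| < ε and |v'-v| < ε one has |f^{-1}(v') - g^{-1}(u')| < W. -/

import Mathlib

open MeasureTheory Filter Set
open scoped ENNReal

noncomputable section

/-- Convolution `(p ⊗ w)(x) = ∫ p(y) w(x-y) dy`. -/
def convw (p w : ℝ → ℝ) (x : ℝ) : ℝ := ∫ y, p y * w (x - y)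

/-- `w` is a window: bounded, nonnegative, even, integrable, normalized. -/
structure IsWindow (w : ℝ → ℝ) : Prop where
  nonneg : ∀ x, 0 ≤ w x
  even : ∀ x, w (-x) = w x
  bounded : ∃ M, ∀ x, w x ≤ M
  integrable : Integrable w
  normalized : (∫ x, w x) = 1

/-- Generalized inverse `h⁻¹(u) = inf {v ∈ [0,1] : h v > u}`. -/
def geninv (h : ℝ → ℝ) (u : ℝ) : ℝ := sInf {v | v ∈ Icc (0:ℝ) 1 ∧ u < h v}

/-- `h` is an update function: nondecreasing from [0,1] to [0,1] with h 0 = 0, h 1 = 1. -/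
def IsUpdate (h : ℝ → ℝ) : Prop :=
  MonotoneOn h (Icc (0:ℝ) 1) ∧ (∀ v ∈ Icc (0:ℝ) 1, h v ∈ Icc (0:ℝ) 1) ∧ h 0 = 0 ∧ h 1 = 1

/-- The potential function φ(u,v). -/
def pot (hf hg : ℝ → ℝ) (u v : ℝ) : ℝ :=
  (∫ u' in (0:ℝ)..u, geninv hg u') + (∫ v' in (0:ℝ)..v, geninv hf v') - u * v

/-- The positive gap condition. -/
def PGC (hf hg : ℝ → ℝ) : Prop :=
  pot hf hg 1 1 = 0 ∧ ∀ u ∈ Icc (0:ℝ) 1, ∀ v ∈ Icc (0:ℝ) 1, 0 ≤ pot hf hg u v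

/-- The strictly positive gap condition. -/
def SPGC (hf hg : ℝ → ℝ) : Prop :=
  pot hf hg 1 1 = 0 ∧ ∀ u ∈ Icc (0:ℝ) 1, ∀ v ∈ Icc (0:ℝ) 1,
    (u, v) ≠ ((0:ℝ), (0:ℝ)) → (u, v) ≠ ((1:ℝ), (1:ℝ)) → 0 < pot hf hg u v

/-- Interpolating profile: takes values in [0,1], tends to 0 at -∞ and to 1 at +∞. -/
def IsProfile (p : ℝ → ℝ) : Prop :=
  (∀ x, p x ∈ Icc (0:ℝ) 1) ∧ Tendsto p atBot (nhds 0) ∧ Tendsto p atTop (nhds 1)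

/-- `H(t) = ∫_0^t h⁻¹`. -/
def Hfun (h : ℝ → ℝ) (t : ℝ) : ℝ := ∫ v in (0:ℝ)..t, geninv h v

/-- The potential functional `W(f,g)`, valued in [0,∞]. -/
def Wfun (w hf hg f g : ℝ → ℝ) : ℝ≥0∞ :=
  ∫⁻ x, ENNReal.ofReal
    (Hfun hg (g x) + convw (fun y => Hfun hf (f y)) w x - convw f w x * g x)

/-- Saturation of a profile `f` at level `K`. -/
def cut (f : ℝ → ℝ) (K : ℝ) (x : ℝ) : ℝ :=
  (if |x| ≤ K then f x else 0) + (if K < x then 1 else 0)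

/-- Left endpoint of the maximal half-line contained in the level set `{x : p x > t}`. -/
def aT (p : ℝ → ℝ) (t : ℝ) : ℝ := sInf {a : ℝ | Ioi a ⊆ {x | t < p x}}

/-- Increasing rearrangement of an interpolating profile. -/
def rearr (p : ℝ → ℝ) (x : ℝ) : ℝ :=
  (volume {t : ℝ | t ∈ Ioo (0:ℝ) 1 ∧
    aT p t - (volume ({x | t < p x} \ Ioi (aT p t))).toReal < x}).toReal

/-- `Ω(x) = ∫_{-∞}^x w`. -/
def Om (w : ℝ → ℝ) (x : ℝ) : ℝ := ∫ z in Iic x, w z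

/-- The kernel `V(x) = ∫_{-∞}^x Ω`. -/
def Vker (w : ℝ → ℝ) (x : ℝ) : ℝ := ∫ z in Iic x, Om w z

/-- `κ(x) = V(x) - x Ω(x)`. -/
def kap (w : ℝ → ℝ) (x : ℝ) : ℝ := Vker w x - x * Om w x

/-- Right-continuous generalized inverse of a profile. -/
def rinv (p : ℝ → ℝ) (u : ℝ) : ℝ := sInf {x | u < p x}

/-- Displacement interpolant of two nondecreasing interpolating profiles. -/
def dispInterp (p0 p1 : ℝ → ℝ) (l x : ℝ) : ℝ :=
  sInf {u | u ∈ Ioo (0:ℝ) 1 ∧ x < (1 - l) * rinv p0 u + l * rinv p1 u}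

/-- A profile saturated off of the interval [-K,K]. -/
def Saturated (f : ℝ → ℝ) (K : ℝ) : Prop :=
  (∀ x, x < -K → f x = 0) ∧ (∀ x, K < x → f x = 1)

/-- Consistent fixed point. -/
def IsCFP (w hf hg f g : ℝ → ℝ) : Prop :=
  ∀ x, f x ∈ Icc (Function.leftLim hf (convw g w x)) (Function.rightLim hf (convw g w x)) ∧
       g x ∈ Icc (Function.leftLim hg (convw f w x)) (Function.rightLim hg (convw f w x))

/-- Interval support condition with parameter `W ∈ (0,∞]`. -/
def IntervalSupport (w : ℝ → ℝ) (W : ℝ≥0∞) : Prop :=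
  ∀ x : ℝ, (ENNReal.ofReal |x| < W → 0 < w x) ∧ (W < ENNReal.ofReal |x| → w x = 0)

/-- The functional `L(f,g)`. -/
def Lfun (hf hg f g : ℝ → ℝ) : ℝ :=
  ∫ x, ((∫ v in (0:ℝ)..f x, geninv hf v) - ∫ u in (0:ℝ)..g x, (1 - geninv hg u))

section Inverse

variable {p : ℝ → ℝ}

lemma rinv_le (hp : IsProfile p) {u x : ℝ} (hu : 0 < u) (h : u < p x) : rinv p u ≤ x := by
  refine csInf_le ?_ h
  obtain ⟨b, hb⟩ := eventually_atBot.1 (hp.2.1.eventually (gt_mem_nhds hu))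
  refine ⟨b, fun y hy => ?_⟩
  by_contra! hyb
  exact lt_asymm hy (hb y hyb.le)

lemma exists_lt_profile (hp : IsProfile p) {u : ℝ} (hu : u < 1) : ∃ x, u < p x :=
  (hp.2.2.eventually (lt_mem_nhds hu)).exists

lemma lt_of_rinv_lt (hp : IsProfile p) (hpm : Monotone p) {u x : ℝ} (hu : u < 1)
    (h : rinv p u < x) : u < p x := by
  obtain ⟨y, hy, hyx⟩ := exists_lt_of_csInf_lt (exists_lt_profile hp hu) h
  exact lt_of_lt_of_le hy (hpm hyx.le)

lemma rinv_monotoneOn (hp : IsProfile p) : MonotoneOn (rinv p) (Ioo 0 1) := by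
  intro a ha b hb hab
  exact le_csInf (exists_lt_profile hp hb.2) fun y hy => rinv_le hp ha.1 (hab.trans_lt hy)

end Inverse

section Primitive

variable {w : ℝ → ℝ}

lemma continuous_Om (hw : IsWindow w) : Continuous (Om w) := by
  have h : Om w = fun x => Om w 0 + ∫ z in (0:ℝ)..x, w z := by
    funext x
    rw [← intervalIntegral.integral_Iic_sub_Iic hw.integrable.integrableOn
      hw.integrable.integrableOn]
    simp [Om]
  rw [h]
  exact continuous_const.add
    (intervalIntegral.continuous_primitive (fun _ _ => hw.integrable.intervalIntegrable) 0)

lemma Om_nonneg (hw : IsWindow w) (x : ℝ) : 0 ≤ Om w x :=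
  integral_nonneg fun z => hw.nonneg z

lemma Om_add_Om_neg (hw : IsWindow w) (x : ℝ) : Om w x + Om w (-x) = 1 := by
  have h : Om w (-x) = ∫ z in Ioi x, w z := by
    have := integral_comp_neg_Iic (-x) w
    simp only [hw.even, neg_neg] at this
    exact this
  rw [h, Om, ← hw.normalized, ← compl_Iic]
  exact integral_add_compl measurableSet_Iic hw.integrable

lemma Om_le_one (hw : IsWindow w) (x : ℝ) : Om w x ≤ 1 := by
  have := Om_add_Om_neg hw x
  have := Om_nonneg hw (-x)
  linarith

lemma Om_eq_zero {R x : ℝ} (hR : ∀ z, R < |z| → w z = 0) (hx : x ≤ -R) : Om w x = 0 := by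
  rw [Om, integral_Iic_eq_integral_Iio]
  refine setIntegral_eq_zero_of_forall_eq_zero fun z hz => hR z ?_
  have : z < x := hz
  linarith [neg_le_abs z]

end Primitive

section Convolution

variable {p w : ℝ → ℝ}

lemma convw_eq_integral_Om (hw : IsWindow w) (hp : IsProfile p) (hpm : Monotone p) (x : ℝ) :
    convw p w x = ∫ u in Ioo (0:ℝ) 1, Om w (x - rinv p u) := by
  have hwx : Integrable fun y => w (x - y) := hw.integrable.comp_sub_left x
  have hlayer : ∀ y, p y * w (x - y) =
      ∫ u in Ioo (0:ℝ) 1, (if u < p y then w (x - y) else 0) := by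
    intro y
    have h1 : (fun u => if u < p y then w (x - y) else 0) =
        (Iio (p y)).indicator fun _ => w (x - y) := by
      funext u; simp [indicator]
    rw [h1, setIntegral_indicator measurableSet_Iio, setIntegral_const, Ioo_inter_Iio,
      min_eq_right (hp.1 y).2]
    simp [Measure.real, (hp.1 y).1]
  have hmeas : MeasurableSet {q : ℝ × ℝ | q.2 < p q.1} :=
    measurableSet_lt measurable_snd (hpm.measurable.comp measurable_fst)
  have hint : Integrable (Function.uncurry fun y u : ℝ => if u < p y then w (x - y) else 0)
      (volume.prod (volume.restrict (Ioo (0:ℝ) 1))) := by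
    have h1 : Integrable (fun q : ℝ × ℝ => w (x - q.1) * 1)
        (volume.prod (volume.restrict (Ioo (0:ℝ) 1))) :=
      hwx.mul_prod (integrable_const (1:ℝ))
    refine (h1.indicator hmeas).congr (ae_of_all _ fun q => ?_)
    simp [indicator, Function.uncurry]
  unfold convw
  simp_rw [hlayer]
  rw [integral_integral_swap hint]
  refine setIntegral_congr_fun measurableSet_Ioo fun u hu => ?_
  simp only [Om]
  rw [← integral_indicator measurableSet_Iic,
    ← integral_sub_left_eq_self ((Iic (x - rinv p u)).indicator w) volume x]
  refine integral_congr_ae ?_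
  filter_upwards [compl_mem_ae_iff.2 (measure_singleton (rinv p u))] with y hy
  have hy : y ≠ rinv p u := hy
  have hiff : u < p y ↔ x - y ∈ Iic (x - rinv p u) := by
    simp only [mem_Iic, sub_le_sub_iff_left]
    exact ⟨fun h => rinv_le hp hu.1 h,
      fun h => lt_of_rinv_lt hp hpm hu.2 (lt_of_le_of_ne h hy.symm)⟩
  by_cases hc : u < p y
  · rw [if_pos hc, indicator_of_mem (hiff.1 hc)]
  · rw [if_neg hc, indicator_of_notMem (mt hiff.2 hc)]

lemma aemeasurable_rinv (hp : IsProfile p) {s : Set ℝ} (hs : MeasurableSet s)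
    (hs1 : s ⊆ Ioo 0 1) : AEMeasurable (rinv p) (volume.restrict s) :=
  aemeasurable_restrict_of_monotoneOn hs ((rinv_monotoneOn hp).mono hs1)

lemma continuous_convw (hw : IsWindow w) (hp : IsProfile p) (hpm : Monotone p) :
    Continuous (convw p w) := by
  rw [funext (convw_eq_integral_Om hw hp hpm)]
  refine continuous_of_dominated (bound := fun _ => 1) (fun x => ?_) (fun x => ?_)
    (integrable_const _) ?_
  · exact ((continuous_Om hw).measurable.comp_aemeasurable
      ((aemeasurable_rinv hp measurableSet_Ioo subset_rfl).const_sub x)).aestronglyMeasurable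
  · refine ae_of_all _ fun u => ?_
    rw [Real.norm_of_nonneg (Om_nonneg hw _)]
    exact Om_le_one hw _
  · exact ae_of_all _ fun u => (continuous_Om hw).comp (continuous_id.sub continuous_const)

lemma convw_nonneg (hw : IsWindow w) (hp : IsProfile p) (x : ℝ) : 0 ≤ convw p w x :=
  integral_nonneg fun y => mul_nonneg (hp.1 y).1 (hw.nonneg _)

lemma integrable_Om_rinv_sub {q : ℝ → ℝ} (hw : IsWindow w) (hp : IsProfile p) (hq : IsProfile q)
    {s t : Set ℝ} (hs : MeasurableSet s) (hs1 : s ⊆ Ioo 0 1)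
    (ht : MeasurableSet t) (ht1 : t ⊆ Ioo 0 1) :
    Integrable (fun z : ℝ × ℝ => Om w (rinv p z.1 - rinv q z.2))
      ((volume.restrict s).prod (volume.restrict t)) := by
  have hsf : IsFiniteMeasure (volume.restrict s) :=
    isFiniteMeasure_restrict.2 ((measure_mono hs1).trans_lt (by simp)).ne
  have htf : IsFiniteMeasure (volume.restrict t) :=
    isFiniteMeasure_restrict.2 ((measure_mono ht1).trans_lt (by simp)).ne
  refine Integrable.of_bound (C := 1) ?_ (ae_of_all _ fun z => ?_)
  · exact ((continuous_Om hw).measurable.comp_aemeasurable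
      ((aemeasurable_rinv hp hs hs1).comp_fst.sub
        (aemeasurable_rinv hq ht ht1).comp_snd)).aestronglyMeasurable
  · rw [Real.norm_of_nonneg (Om_nonneg hw _)]
    exact Om_le_one hw _

end Convolution

section Update

variable {h : ℝ → ℝ}

lemma geninv_nonneg (u : ℝ) : 0 ≤ geninv h u := Real.sInf_nonneg fun _ hv => hv.1.1

lemma geninv_le {u v : ℝ} (hv : v ∈ Icc (0:ℝ) 1) (huv : u < h v) : geninv h u ≤ v :=
  csInf_le ⟨0, fun _ hv => hv.1.1⟩ ⟨hv, huv⟩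

lemma rightLim_le_of_lt (hh : IsUpdate h) {c t : ℝ} (hc : 0 ≤ c) (hct : c < t) (ht : t ≤ 1) :
    Function.rightLim h c ≤ h t := by
  by_cases hlim : ∃ y, Tendsto h (nhdsWithin c (Ioi c)) (nhds y)
  · obtain ⟨y, hy⟩ := hlim
    rw [rightLim_eq_of_tendsto hy]
    refine le_of_tendsto hy ?_
    filter_upwards [Ioo_mem_nhdsGT hct] with s hs
    exact hh.1 ⟨hc.trans hs.1.le, hs.2.le.trans ht⟩ ⟨hc.trans hct.le, ht⟩ hs.2.le
  · rw [rightLim_eq_of_not_tendsto h hlim]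
    exact hh.1 ⟨hc, hct.le.trans ht⟩ ⟨hc.trans hct.le, ht⟩ hct.le

/-- If `v` lies below the right limit of `h` at `c`, then `h⁻¹(v) ≤ c`. -/
lemma geninv_le_of_lt_rightLim (hh : IsUpdate h) {c v : ℝ} (hc : 0 ≤ c) (hv : v < 1)
    (hvc : v < Function.rightLim h c) : geninv h v ≤ c := by
  rcases lt_or_ge c 1 with hc1 | hc1
  · refine le_of_forall_gt_imp_ge_of_dense fun t hct => ?_
    rcases le_or_gt t 1 with ht | ht
    · exact geninv_le ⟨hc.trans hct.le, ht⟩ (hvc.trans_le (rightLim_le_of_lt hh hc hct ht))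
    · exact (geninv_le ⟨zero_le_one, le_rfl⟩ (by rw [hh.2.2.2]; exact hv)).trans ht.le
  · exact (geninv_le ⟨zero_le_one, le_rfl⟩ (by rw [hh.2.2.2]; exact hv)).trans hc1

variable {p q w : ℝ → ℝ}

/-- One side of the identity `h⁻¹(v) = q^w(p⁻¹(v))` satisfied by a fixed point. -/
lemma geninv_le_convw_rinv (hw : IsWindow w) (hh : IsUpdate h) (hp : IsProfile p)
    (hpm : Monotone p) (hq : IsProfile q) (hqm : Monotone q)
    (hfix : ∀ x, p x ≤ Function.rightLim h (convw q w x)) {v : ℝ} (hv : v < 1) :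
    geninv h v ≤ convw q w (rinv p v) := by
  refine ge_of_tendsto
    (((continuous_convw hw hq hqm).tendsto (rinv p v)).mono_left (nhdsWithin_le_nhds
      (s := Ioi (rinv p v)))) ?_
  filter_upwards [self_mem_nhdsWithin] with y hy
  exact geninv_le_of_lt_rightLim hh (convw_nonneg hw hq y) hv
    ((lt_of_rinv_lt hp hpm hv hy).trans_le (hfix y))

/-- If the window does not reach from the `q`-quantiles above `b` to the `p`-quantiles
below `a`, then the integral of `h⁻¹` over `[0,a]` only sees the `q`-quantiles below `b`. -/
lemma integral_geninv_le (hw : IsWindow w) (hh : IsUpdate h) (hp : IsProfile p)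
    (hpm : Monotone p) (hq : IsProfile q) (hqm : Monotone q)
    (hfix : ∀ x, p x ≤ Function.rightLim h (convw q w x)) {R : ℝ}
    (hR : ∀ z, R < |z| → w z = 0) {a b : ℝ} (ha : a ∈ Icc (0:ℝ) 1) (hb : b ∈ Icc (0:ℝ) 1)
    (hsep : ∀ s ∈ Ioo 0 a, ∀ t ∈ Ioo b 1, rinv p s ≤ rinv q t - R) :
    (∫ s in (0:ℝ)..a, geninv h s) ≤
      ∫ s in Ioo 0 a, ∫ t in Ioo 0 b, Om w (rinv p s - rinv q t) := by
  have hsa : Ioo 0 a ⊆ Ioo (0:ℝ) 1 := Ioo_subset_Ioo_right ha.2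
  have hsb : Ioo 0 b ⊆ Ioo (0:ℝ) 1 := Ioo_subset_Ioo_right hb.2
  rw [intervalIntegral.integral_of_le ha.1, integral_Ioc_eq_integral_Ioo]
  refine integral_mono_of_nonneg (ae_of_all _ fun s => geninv_nonneg s) ?_ ?_
  · exact (integrable_Om_rinv_sub hw hp hq measurableSet_Ioo hsa
      measurableSet_Ioo hsb).integral_prod_left
  · refine (ae_restrict_mem measurableSet_Ioo).mono fun s hs => ?_
    refine (geninv_le_convw_rinv hw hh hp hpm hq hqm hfix (hsa hs).2).trans_eq ?_
    rw [convw_eq_integral_Om hw hq hqm]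
    refine setIntegral_eq_of_subset_of_ae_sdiff_eq_zero measurableSet_Ioo.nullMeasurableSet hsb ?_
    filter_upwards [compl_mem_ae_iff.2 (measure_singleton b)] with t htb ht
    have htb : t ≠ b := htb
    have hbt : b < t := by
      by_contra! hle
      exact ht.2 ⟨ht.1.1, lt_of_le_of_ne hle htb⟩
    exact Om_eq_zero hR (by linarith [hsep s hs t ⟨hbt, ht.1.2⟩])

end Update

section Separation

variable {w hf hg f g : ℝ → ℝ}

/-- The potential is nonpositive at a pair of levels across which the fixed point decouples. -/
lemma pot_nonpos_of_separated (hw : IsWindow w) (hhf : IsUpdate hf) (hhg : IsUpdate hg)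
    (hfp : IsProfile f) (hgp : IsProfile g) (hfm : Monotone f) (hgm : Monotone g)
    (hcfp : IsCFP w hf hg f g) {R : ℝ} (hR : ∀ z, R < |z| → w z = 0) {u v : ℝ}
    (hu : u ∈ Icc (0:ℝ) 1) (hv : v ∈ Icc (0:ℝ) 1)
    (hgf : ∀ s ∈ Ioo 0 u, ∀ t ∈ Ioo v 1, rinv g s ≤ rinv f t - R)
    (hfg : ∀ t ∈ Ioo 0 v, ∀ s ∈ Ioo u 1, rinv f t ≤ rinv g s - R) :
    pot hf hg u v ≤ 0 := by
  have hsu : Ioo 0 u ⊆ Ioo (0:ℝ) 1 := Ioo_subset_Ioo_right hu.2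
  have hsv : Ioo 0 v ⊆ Ioo (0:ℝ) 1 := Ioo_subset_Ioo_right hv.2
  have h1 := integral_geninv_le hw hhg hgp hgm hfp hfm (fun x => (hcfp x).2.2) hR hu hv hgf
  have h2 := integral_geninv_le hw hhf hfp hfm hgp hgm (fun x => (hcfp x).1.2) hR hv hu hfg
  have hswap := integral_integral_swap (f := fun t s => Om w (rinv f t - rinv g s))
    (integrable_Om_rinv_sub hw hfp hgp measurableSet_Ioo hsv measurableSet_Ioo hsu)
  have hinner : ∀ s, ∫ t in Ioo 0 v, Om w (rinv f t - rinv g s) =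
      ∫ t in Ioo 0 v, (1 - Om w (rinv g s - rinv f t)) := fun s => by
    refine integral_congr_ae (ae_of_all _ fun t => ?_)
    have := Om_add_Om_neg hw (rinv g s - rinv f t)
    rw [neg_sub] at this
    exact eq_sub_of_add_eq' this
  have hG := integrable_Om_rinv_sub hw hgp hfp measurableSet_Ioo hsu measurableSet_Ioo hsv
  have hone : Integrable (fun _ : ℝ × ℝ => (1:ℝ))
      ((volume.restrict (Ioo 0 u)).prod (volume.restrict (Ioo 0 v))) := integrable_const _
  have hsub := integral_integral_sub hone hG
  simp only [integral_const, smul_eq_mul, mul_one, measureReal_restrict_apply_univ,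
    Real.volume_real_Ioo_of_le hu.1, Real.volume_real_Ioo_of_le hv.1, sub_zero] at hsub
  simp_rw [hinner] at hswap
  rw [hswap, hsub] at h2
  unfold pot
  linarith

end Separation

/-- Under the SPGC and the interval support condition with parameter `W`,
if `(f,g)` is a consistent fixed point of nondecreasing interpolating profiles, then for
every `v ∈ (0,1)` there are `u ∈ (0,1)` and `ε > 0` such that for all `(u',v')` with
`|u'-u| < ε`, `|v'-v| < ε` one has `|f⁻¹(v') - g⁻¹(u')| < W`. -/
theorem stmt16 (w hf hg f g : ℝ → ℝ) (W : ℝ≥0∞) (hW : 0 < W)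
    (hw : IsWindow w) (hsup : IntervalSupport w W)
    (hhf : IsUpdate hf) (hhg : IsUpdate hg) (hspgc : SPGC hf hg)
    (hfp : IsProfile f) (hgp : IsProfile g)
    (hfm : Monotone f) (hgm : Monotone g)
    (hcfp : IsCFP w hf hg f g) :
    ∀ v ∈ Ioo (0:ℝ) 1, ∃ u ∈ Ioo (0:ℝ) 1, ∃ ε > (0:ℝ),
      ∀ u' v' : ℝ, |u' - u| < ε → |v' - v| < ε →
        ENNReal.ofReal |rinv f v' - rinv g u'| < W := by
  intro v hv
  induction W using ENNReal.recTopCoe with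
  | top => exact ⟨1 / 2, by norm_num, 1, one_pos, fun _ _ _ _ => ENNReal.ofReal_lt_top⟩
  | coe r =>
  set R : ℝ := NNReal.toReal r
  have hlt : ∀ x : ℝ, |x| < R → ENNReal.ofReal |x| < r := fun x hx => by
    rw [ENNReal.ofReal_lt_iff_lt_toReal (abs_nonneg x) ENNReal.coe_ne_top]
    exact hx
  have hR : ∀ z, R < |z| → w z = 0 := fun z hz => (hsup z).2 (by
    rw [ENNReal.lt_ofReal_iff_toReal_lt ENNReal.coe_ne_top]
    exact hz)
  by_contra! hbad
  have hF := rinv_monotoneOn hfp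
  have hG := rinv_monotoneOn hgp
  -- The level of `g` up to which its quantiles stay at least `R` below those of `f` above `v`.
  set S : Set ℝ := {u | u = 0 ∨ u ∈ Ioo (0:ℝ) 1 ∧ ∀ t ∈ Ioo v 1, rinv g u ≤ rinv f t - R}
  have hSle : ∀ u ∈ S, u ≤ 1 := by
    rintro u (rfl | hu)
    · exact zero_le_one
    · exact hu.1.2.le
  have hSbdd : BddAbove S := ⟨1, hSle⟩
  have h0S : (0:ℝ) ∈ S := Or.inl rfl
  have hu : sSup S ∈ Icc (0:ℝ) 1 := ⟨le_csSup hSbdd h0S, csSup_le ⟨0, h0S⟩ hSle⟩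
  refine absurd (pot_nonpos_of_separated hw hhf hhg hfp hgp hfm hgm hcfp hR hu
    ⟨hv.1.le, hv.2.le⟩ ?_ ?_) (not_le.2 (hspgc.2 _ hu _ ⟨hv.1.le, hv.2.le⟩ ?_ ?_))
  · intro s hs t ht
    obtain ⟨u, huS, hsu⟩ := exists_lt_of_lt_csSup ⟨0, h0S⟩ hs.2
    rcases huS with rfl | huS
    · exact absurd hs.1 hsu.not_gt
    · exact (hG ⟨hs.1, hsu.trans huS.1.2⟩ huS.1 hsu.le).trans (huS.2 t ht)
  · intro t ht s hs
    by_contra! hts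
    obtain ⟨u, hu1, hus⟩ := exists_between hs.1
    obtain ⟨u₀, hu₀, hu₀u⟩ := exists_between hu1
    have hu₀0 : 0 < u₀ := hu.1.trans_lt hu₀
    have hu₀S : u₀ ∉ S := fun h => (le_csSup hSbdd h).not_gt hu₀
    have hu₀1 : u₀ < 1 := (hu₀u.trans hus).trans hs.2
    obtain ⟨t₁, ht₁, hgt⟩ : ∃ t ∈ Ioo v 1, rinv f t - R < rinv g u₀ := by
      by_contra! h
      exact hu₀S (Or.inr ⟨⟨hu₀0, hu₀1⟩, h⟩)
    obtain ⟨ε, hε, hεu, hεs, hεt, hεt₁⟩ : ∃ ε > 0, ε ≤ u - u₀ ∧ ε ≤ s - u ∧ ε ≤ v - t ∧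
        ε ≤ t₁ - v := by
      refine ⟨min (min (u - u₀) (s - u)) (min (v - t) (t₁ - v)), ?_, ?_, ?_, ?_, ?_⟩
      · simp [hu₀u, hus, ht.2, ht₁.1]
      all_goals simp
    obtain ⟨u', v', hu', hv', hW'⟩ :=
      hbad u ⟨hu₀0.trans hu₀u, hus.trans hs.2⟩ ε hε
    refine absurd (hlt _ ?_) hW'.not_gt
    rw [abs_lt] at hu' hv' ⊢
    have hu'I : u' ∈ Ioo (0:ℝ) 1 := ⟨by linarith, by linarith [hs.2]⟩
    have hv'I : v' ∈ Ioo (0:ℝ) 1 := ⟨by linarith [ht.1], by linarith [ht₁.2]⟩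
    have e1 := hG ⟨hu₀0, hu₀1⟩ hu'I (by linarith)
    have e2 := hG hu'I ⟨hu'I.1.trans (by linarith), hs.2⟩ (by linarith)
    have e3 := hF ⟨ht.1, ht.2.trans hv.2⟩ hv'I (by linarith)
    have e4 := hF hv'I ⟨hv.1.trans ht₁.1, ht₁.2⟩ (by linarith)
    constructor <;> linarith
  · exact fun h => hv.1.ne' (Prod.ext_iff.1 h).2
  · exact fun h => hv.2.ne (Prod.ext_iff.1 h).2

end
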